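/- arXiv:cs/0602007 — 2 statements merged into one kernel-verified Lean document; each statement's English description precedes it below -/
import Mathlib

section
/- Assume algorithms SS and Rec satisfy the correctness property of a secure sketch for distance t on a finite metric space M, and that the output range of SS has size at most 2^λ. Then, for any min-entropy threshold m and any 0 < ε ≤ 1, there exists an average-case (M, m, m − λ − 2·log₂(1/ε) + 2, t, ε)-fuzzy extractor for M; in particular, for any m, the entropy loss of the fuzzy extractor is at most λ + 2·log₂(1/ε) − 2. -/
open Finset

/-- A probability distribution on a finite type. -/
def IsDist {α : Type*} [Fintype α] (p : α → ℝ) : Prop :=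
  (∀ a, 0 ≤ p a) ∧ ∑ a, p a = 1

/-- Average min-entropy `H̃∞(A | B)`. -/
noncomputable def avgMinEntropy {α β : Type*} [Fintype α] [Fintype β] (p : α × β → ℝ) : ℝ :=
  - Real.logb 2 (∑ b, ⨆ a, p (a, b))

/-- Statistical distance between two distributions on the same finite type. -/
noncomputable def statDist {V : Type*} [Fintype V] (p q : V → ℝ) : ℝ :=
  (∑ v, |p v - q v|) / 2

/-- Distribution of `(R, P, I)` where `(R, P) = Gen(W)` with uniform coins from `C`
and `p` is the joint distribution of `(W, I)`. -/
noncomputable def genDistI {M C O P ι : Type*} [Fintype M] [Fintype C] [Fintype O] [Fintype P]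
    [Fintype ι] [DecidableEq O] [DecidableEq P]
    (Gen : M → C → O × P) (p : M × ι → ℝ) : O × P × ι → ℝ :=
  fun x => (∑ wc : M × C, if Gen wc.1 wc.2 = (x.1, x.2.1) then p (wc.1, x.2.2) else 0)
    / (Fintype.card C : ℝ)

/-- Distribution of `(U_ℓ, P, I)` where `P` is the helper string produced by `Gen(W)`. -/
noncomputable def genUniI {M C O P ι : Type*} [Fintype M] [Fintype C] [Fintype O] [Fintype P]
    [Fintype ι] [DecidableEq O] [DecidableEq P]
    (Gen : M → C → O × P) (p : M × ι → ℝ) : O × P × ι → ℝ :=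
  fun x => (∑ y : O, genDistI Gen p (y, x.2)) / (Fintype.card O : ℝ)

/-- Centred functions evaluated at distinct points of a uniformly random function are
uncorrelated. -/
theorem sum_pi_mul_eq_zero {M O : Type*} [Fintype M] [DecidableEq M] [Fintype O]
    (f g : O → ℝ) (hf : ∑ o, f o = 0) {w w' : M} (hw : w' ≠ w) :
    ∑ h : M → O, f (h w) * g (h w') = 0 := by
  rw [← (Equiv.funSplitAt w O).symm.sum_comp, Fintype.sum_prod_type_right]
  refine Finset.sum_eq_zero fun k _ => ?_
  simp [Equiv.funSplitAt, Equiv.piSplitAt, hw, ← Finset.sum_mul, hf]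

theorem sum_pi_sq {M O : Type*} [Fintype M] [DecidableEq M] [Fintype O]
    (f : O → ℝ) (hf : ∑ o, f o = 0) (q : M → ℝ) :
    ∑ h : M → O, (∑ w, f (h w) * q w) ^ 2 = ∑ h : M → O, ∑ w, f (h w) ^ 2 * q w ^ 2 := by
  simp_rw [sq (∑ w, _), Finset.sum_mul_sum]
  rw [Finset.sum_comm, Finset.sum_comm (s := univ (α := M → O))]
  refine Finset.sum_congr rfl fun w _ => ?_
  rw [Finset.sum_comm, Finset.sum_eq_single w]
  · exact Finset.sum_congr rfl fun h _ => by ring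
  · intro w' _ hw
    have := sum_pi_mul_eq_zero f f hf hw
    calc _ = (∑ h : M → O, f (h w) * f (h w')) * (q w * q w') := by
          rw [Finset.sum_mul]; exact Finset.sum_congr rfl fun h _ => by ring
      _ = 0 := by rw [this, zero_mul]
  · simp

/-- The leftover hash lemma for the family of all functions, for an unnormalised source. -/
theorem sq_sum_abs_hash_le {M O : Type*} [Fintype M] [DecidableEq M] [Fintype O] [DecidableEq O]
    [Nonempty O] (q : M → ℝ) :
    (∑ o : O, ∑ h : M → O,
      |∑ w, ((if h w = o then 1 else 0) - (Fintype.card O : ℝ)⁻¹) * q w|) ^ 2 ≤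
      (Fintype.card (M → O) : ℝ) ^ 2 * Fintype.card O * ∑ w, q w ^ 2 := by
  have hL : (Fintype.card O : ℝ) ≠ 0 := by simp
  have centred (o : O) : ∑ a : O, ((if a = o then (1 : ℝ) else 0) - (Fintype.card O : ℝ)⁻¹) = 0 := by
    simp [Finset.sum_sub_distrib, hL]
  have variance (a : O) :
      ∑ o : O, ((if a = o then (1 : ℝ) else 0) - (Fintype.card O : ℝ)⁻¹) ^ 2 ≤ 1 := by
    have : ∑ o : O, ((if a = o then (1 : ℝ) else 0) - (Fintype.card O : ℝ)⁻¹) ^ 2 =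
        1 - (Fintype.card O : ℝ)⁻¹ := by
      have expand (o : O) : ((if a = o then (1 : ℝ) else 0) - (Fintype.card O : ℝ)⁻¹) ^ 2 =
          (if a = o then 1 else 0) * (1 - 2 * (Fintype.card O : ℝ)⁻¹) +
            (Fintype.card O : ℝ)⁻¹ ^ 2 := by
        split_ifs <;> ring
      simp_rw [expand, Finset.sum_add_distrib, ← Finset.sum_mul]
      simp
      field_simp
      ring
    rw [this]
    have : (0 : ℝ) ≤ (Fintype.card O : ℝ)⁻¹ := by positivity
    linarith
  rw [← Fintype.sum_prod_type']
  refine (sq_sum_le_card_mul_sum_sq (s := univ)).trans ?_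
  have second : ∑ x : O × (M → O),
      |∑ w, ((if x.2 w = x.1 then 1 else 0) - (Fintype.card O : ℝ)⁻¹) * q w| ^ 2 ≤
      Fintype.card (M → O) * ∑ w, q w ^ 2 := by
    simp_rw [sq_abs]
    rw [Fintype.sum_prod_type]
    simp only
    rw [Finset.sum_congr rfl fun o _ => sum_pi_sq _ (centred o) q, Finset.sum_comm]
    calc _ ≤ ∑ h : M → O, ∑ w, q w ^ 2 := by
          refine Finset.sum_le_sum fun h _ => ?_
          rw [Finset.sum_comm]
          refine Finset.sum_le_sum fun w _ => ?_
          rw [← Finset.sum_mul]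
          exact mul_le_of_le_one_left (sq_nonneg _) (variance _)
      _ = _ := by simp
  calc _ ≤ ((univ : Finset (O × (M → O))).card : ℝ) *
        (Fintype.card (M → O) * ∑ w, q w ^ 2) := by gcongr
    _ = _ := by
      rw [Finset.card_univ, Fintype.card_prod]
      push_cast
      ring

/-- The leftover hash lemma with side information `a`, where `ν a` bounds the largest joint
probability of a source value together with `a`. -/
theorem sq_sum_abs_hash_le_of_le {M O A : Type*} [Fintype M] [DecidableEq M] [Fintype O]
    [DecidableEq O] [Nonempty O] [Fintype A] (q : M → A → ℝ) (ν : A → ℝ)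
    (hq : ∀ w a, 0 ≤ q w a) (hν : ∀ w a, q w a ≤ ν a) (hν0 : ∀ a, 0 ≤ ν a) :
    (∑ a, ∑ o : O, ∑ h : M → O,
      |∑ w, ((if h w = o then 1 else 0) - (Fintype.card O : ℝ)⁻¹) * q w a|) ^ 2 ≤
      (Fintype.card (M → O) : ℝ) ^ 2 * Fintype.card O * ((∑ a, ν a) * ∑ a, ∑ w, q w a) := by
  have key := Finset.sum_sq_le_sum_mul_sum_of_sq_le_mul univ
    (r := fun a => ∑ o : O, ∑ h : M → O,
      |∑ w, ((if h w = o then 1 else 0) - (Fintype.card O : ℝ)⁻¹) * q w a|)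
    (f := fun a => (Fintype.card (M → O) : ℝ) ^ 2 * Fintype.card O * ν a)
    (g := fun a => ∑ w, q w a)
    (fun a _ => mul_nonneg (by positivity) (hν0 a))
    (fun a _ => Finset.sum_nonneg fun w _ => hq w a)
    (fun a _ => by
      refine (sq_sum_abs_hash_le (fun w => q w a)).trans ?_
      rw [mul_assoc _ (ν a)]
      gcongr
      rw [Finset.mul_sum]
      refine Finset.sum_le_sum fun w _ => ?_
      rw [sq]
      exact mul_le_mul_of_nonneg_right (hν w a) (hq w a))
  rwa [← Finset.mul_sum, mul_assoc] at key

/-- The fuzzy extractor that publishes a sketch together with a uniformly random function,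
and extracts the value of that function. -/
def hashGen {M R S O : Type*} (SS : M → R → S) (w : M) (c : R × (M → O)) : O × (S × (M → O)) :=
  (c.2 w, SS w c.1, c.2)

/-- The probability that the randomized map `SS` sends `w` to `s`. -/
noncomputable def sketchProb {M R S : Type*} [Fintype R] [DecidableEq S] (SS : M → R → S)
    (w : M) (s : S) : ℝ :=
  (∑ r, if SS w r = s then 1 else 0) / (Fintype.card R : ℝ)

theorem sketchProb_nonneg {M R S : Type*} [Fintype R] [DecidableEq S] (SS : M → R → S)
    (w : M) (s : S) : 0 ≤ sketchProb SS w s := by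
  unfold sketchProb
  positivity

theorem sum_sketchProb {M R S : Type*} [Fintype R] [Nonempty R] [Fintype S] [DecidableEq S]
    (SS : M → R → S) (w : M) : ∑ s, sketchProb SS w s = 1 := by
  simp only [sketchProb]
  rw [← Finset.sum_div, Finset.sum_comm]
  simp

theorem sketchProb_le_one {M R S : Type*} [Fintype R] [Nonempty R] [Fintype S] [DecidableEq S]
    (SS : M → R → S) (w : M) (s : S) : sketchProb SS w s ≤ 1 :=
  (Finset.single_le_sum (fun s _ => sketchProb_nonneg SS w s) (mem_univ s)).trans
    (sum_sketchProb SS w).le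

theorem sketchProb_eq_zero {M R S : Type*} [Fintype M] [Fintype R] [DecidableEq S]
    (SS : M → R → S) (w : M) {s : S}
    (hs : s ∉ Finset.univ.image fun wr : M × R => SS wr.1 wr.2) : sketchProb SS w s = 0 := by
  have (r : R) : SS w r ≠ s := fun h => hs (Finset.mem_image.2 ⟨(w, r), mem_univ _, h⟩)
  simp [sketchProb, this]

theorem sum_sup_le_of_le_avgMinEntropy {M ι : Type*} [Fintype M] [Nonempty M]
    [Fintype ι] (p : M × ι → ℝ) (hp : IsDist p) {m : ℝ}
    (hm : m ≤ avgMinEntropy p) : ∑ i, ⨆ w, p (w, i) ≤ 2 ^ (-m) := by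
  have le_sup (w : M) (i : ι) : p (w, i) ≤ ⨆ w, p (w, i) :=
    le_ciSup (f := fun w => p (w, i)) (Set.finite_range _).bddAbove w
  have sup_nonneg (i : ι) : 0 ≤ ⨆ w, p (w, i) := Real.iSup_nonneg fun w => hp.1 _
  have pos : 0 < ∑ i, ⨆ w, p (w, i) := by
    refine lt_of_le_of_ne (Finset.sum_nonneg fun i _ => sup_nonneg i) fun h0 => ?_
    have hz := (Finset.sum_eq_zero_iff_of_nonneg fun i _ => sup_nonneg i).1 h0.symm
    have : ∑ x, p x = 0 := Finset.sum_eq_zero fun x _ =>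
      le_antisymm ((le_sup x.1 x.2).trans (hz x.2 (mem_univ _)).le) (hp.1 x)
    exact zero_ne_one (this.symm.trans hp.2)
  rw [← Real.logb_le_iff_le_rpow one_lt_two pos]
  unfold avgMinEntropy at hm
  linarith

section HashGen

variable {M R S O ι : Type*} [Fintype M] [DecidableEq M] [Fintype R] [Fintype S] [DecidableEq S]
  [Fintype O] [DecidableEq O] [Fintype ι] (SS : M → R → S) (p : M × ι → ℝ)

theorem genDistI_hashGen (o : O) (s : S) (h : M → O) (i : ι) :
    genDistI (hashGen (O := O) SS) p (o, (s, h), i) =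
      (∑ w, (if h w = o then 1 else 0) * (sketchProb SS w s * p (w, i))) /
        (Fintype.card (M → O) : ℝ) := by
  have inner (w : M) : (∑ c : R × (M → O),
      if hashGen SS w c = (o, (s, h)) then p (w, i) else 0) =
      (if h w = o then 1 else 0) * ((∑ r, if SS w r = s then 1 else 0) * p (w, i)) := by
    rw [Fintype.sum_prod_type, Finset.sum_mul, Finset.mul_sum]
    refine Finset.sum_congr rfl fun r _ => ?_
    rw [Finset.sum_eq_single h]
    · by_cases h₁ : h w = o <;> by_cases h₂ : SS w r = s <;> simp [hashGen, h₁, h₂]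
    · intro h' _ hne
      simp [hashGen, hne]
    · simp
  simp only [genDistI]
  rw [Fintype.sum_prod_type]
  simp only [inner, sketchProb, Fintype.card_prod, Nat.cast_mul]
  rw [← div_div, Finset.sum_div]
  congr 1
  exact Finset.sum_congr rfl fun w _ => by ring

theorem genDistI_sub_genUniI_hashGen (o : O) (s : S) (h : M → O) (i : ι) :
    genDistI (hashGen (O := O) SS) p (o, (s, h), i) -
        genUniI (hashGen (O := O) SS) p (o, (s, h), i) =
      (∑ w, ((if h w = o then 1 else 0) - (Fintype.card O : ℝ)⁻¹) *
        (sketchProb SS w s * p (w, i))) / (Fintype.card (M → O) : ℝ) := by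
  simp only [genUniI, genDistI_hashGen]
  rw [← Finset.sum_div, Finset.sum_comm]
  simp only [← Finset.sum_mul, Finset.sum_ite_eq, mem_univ, if_true, one_mul, sub_mul,
    Finset.sum_sub_distrib, ← Finset.mul_sum]
  ring

theorem statDist_hashGen_sq_le [Nonempty R] [Nonempty O] (hp : IsDist p) {m : ℝ}
    (hm : m ≤ avgMinEntropy p) :
    (2 * statDist (genDistI (hashGen (O := O) SS) p) (genUniI (hashGen (O := O) SS) p)) ^ 2 ≤
      Fintype.card O *
        ((Finset.univ.image fun wr : M × R => SS wr.1 wr.2).card * 2 ^ (-m)) := by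
  have : Nonempty M := by
    by_contra hM
    rw [not_nonempty_iff] at hM
    exact zero_ne_one (α := ℝ) (by simpa using hp.2)
  set T := Finset.univ.image fun wr : M × R => SS wr.1 wr.2
  have sup_nonneg (i : ι) : 0 ≤ ⨆ w, p (w, i) := Real.iSup_nonneg fun w => hp.1 _
  have hash := sq_sum_abs_hash_le_of_le (O := O) (A := S × ι)
    (fun w a => sketchProb SS w a.1 * p (w, a.2))
    (fun a => if a.1 ∈ T then ⨆ w, p (w, a.2) else 0)
    (fun w a => mul_nonneg (sketchProb_nonneg _ _ _) (hp.1 _))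
    (fun w a => by
      split_ifs with ha
      · exact (mul_le_of_le_one_left (hp.1 _) (sketchProb_le_one SS w a.1)).trans
          (le_ciSup (f := fun w => p (w, a.2)) (Set.finite_range _).bddAbove w)
      · simp [sketchProb_eq_zero SS w ha])
    (fun a => by
      split_ifs
      · exact sup_nonneg _
      · exact le_rfl)
  have mass : ∑ a : S × ι, ∑ w, sketchProb SS w a.1 * p (w, a.2) = 1 := by
    rw [Finset.sum_comm, ← hp.2, Fintype.sum_prod_type]
    refine Finset.sum_congr rfl fun w _ => ?_
    rw [Fintype.sum_prod_type]
    simp only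
    rw [← Finset.sum_mul_sum, sum_sketchProb, one_mul]
  have sups : ∑ a : S × ι, (if a.1 ∈ T then ⨆ w, p (w, a.2) else 0) ≤ T.card * 2 ^ (-m) := by
    rw [Fintype.sum_prod_type_right]
    simp only [Finset.sum_ite_mem, univ_inter, sum_const, nsmul_eq_mul, ← Finset.mul_sum]
    gcongr
    exact sum_sup_le_of_le_avgMinEntropy p hp hm
  have hH : (0 : ℝ) < Fintype.card (M → O) := by exact_mod_cast Fintype.card_pos
  have dist : 2 * statDist (genDistI (hashGen (O := O) SS) p) (genUniI (hashGen (O := O) SS) p) =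
      (∑ a : S × ι, ∑ o : O, ∑ h : M → O,
        |∑ w, ((if h w = o then 1 else 0) - (Fintype.card O : ℝ)⁻¹) *
          (sketchProb SS w a.1 * p (w, a.2))|) / (Fintype.card (M → O) : ℝ) := by
    rw [statDist, mul_div_cancel₀ _ two_ne_zero]
    simp only [Fintype.sum_prod_type, genDistI_sub_genUniI_hashGen, abs_div, abs_of_pos hH]
    simp only [← Finset.sum_div]
    congr 1
    rw [Finset.sum_comm]
    refine Finset.sum_congr rfl fun s _ => ?_
    rw [Finset.sum_comm (s := univ (α := ι))]
    exact Finset.sum_congr rfl fun o _ => Finset.sum_comm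
  rw [dist, div_pow, div_le_iff₀ (by positivity)]
  rw [mass, mul_one] at hash
  refine hash.trans ?_
  calc _ ≤ (Fintype.card (M → O) : ℝ) ^ 2 * Fintype.card O * (T.card * 2 ^ (-m)) := by gcongr
    _ = _ := by ring

end HashGen

section Transport

variable {M C C' O P P' ι : Type*} [Fintype M] [Fintype C] [Fintype C'] [Fintype O] [Fintype P]
  [Fintype P'] [Fintype ι] [DecidableEq O] [DecidableEq P] [DecidableEq P']

theorem genDistI_transport (Gen : M → C → O × P) (e : C ≃ C') (f : P ≃ P') (p : M × ι → ℝ)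
    (o : O) (y : P) (i : ι) :
    genDistI (fun w c => Prod.map id f (Gen w (e.symm c))) p (o, f y, i) =
      genDistI Gen p (o, y, i) := by
  simp only [genDistI]
  rw [Fintype.card_congr e, Fintype.sum_prod_type, Fintype.sum_prod_type]
  congr 1
  refine Finset.sum_congr rfl fun w _ => ?_
  rw [← e.sum_comp]
  simp [Prod.ext_iff]

/-- Relabelling coins and helper strings does not change the distance from uniform. -/
theorem statDist_transport (Gen : M → C → O × P) (e : C ≃ C') (f : P ≃ P') (p : M × ι → ℝ) :
    statDist (genDistI (fun w c => Prod.map id f (Gen w (e.symm c))) p)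
        (genUniI (fun w c => Prod.map id f (Gen w (e.symm c))) p) =
      statDist (genDistI Gen p) (genUniI Gen p) := by
  simp only [statDist, Fintype.sum_prod_type]
  congr 1
  refine Finset.sum_congr rfl fun o _ => ?_
  rw [← f.sum_comp]
  simp only [genUniI, genDistI_transport]

end Transport

/-- If `(SS, Rec)` satisfies the correctness property of a secure
sketch for distance `t` and the range of `SS` has size at most `2^λ`, then for any `m`
and `0 < ε ≤ 1` there exists an average-case `(M, m, m − λ − 2·log₂(1/ε) + 2, t, ε)`-fuzzy
extractor for `M` (i.e., one extracting any number `ℓ` of bits with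
`ℓ ≤ m − λ − 2·log₂(1/ε) + 2`). -/
theorem avg_fuzzy_extractor_of_bounded_range_sketch {M R S : Type}
    [Fintype M] [Fintype R] [Fintype S] [Nonempty R] [DecidableEq S]
    (dis : M → M → ℝ) (t : ℝ) (SS : M → R → S) (Rec : M → S → M) (lam : ℝ)
    (hcorr : ∀ w w' rr, dis w w' ≤ t → Rec w' (SS w rr) = w)
    (hrange : ((Finset.univ.image fun wr : M × R => SS wr.1 wr.2).card : ℝ) ≤ 2 ^ lam)
    (m ε : ℝ) (hε0 : 0 < ε) (hε1 : ε ≤ 1) (ℓ : ℕ)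
    (hℓ : (ℓ : ℝ) ≤ m - lam - 2 * Real.logb 2 (1 / ε) + 2) :
    ∃ (N N' : ℕ), 0 < N ∧
      ∃ (Gen : M → Fin N → (Fin ℓ → Bool) × Fin N') (Rep : M → Fin N' → (Fin ℓ → Bool)),
        -- correctness
        (∀ w w' c, dis w w' ≤ t → Rep w' (Gen w c).2 = (Gen w c).1) ∧
        -- average-case security
        ∀ (ι : Type) [Fintype ι] (p : M × ι → ℝ), IsDist p → m ≤ avgMinEntropy p →
          statDist (genDistI Gen p) (genUniI Gen p) ≤ ε := by
  classical
  let e := Fintype.equivFin (R × (M → Fin ℓ → Bool))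
  let f := Fintype.equivFin (S × (M → Fin ℓ → Bool))
  refine ⟨_, _, Fintype.card_pos, fun w c => Prod.map id f (hashGen SS w (e.symm c)),
    fun w' y => (f.symm y).2 (Rec w' (f.symm y).1), ?_, ?_⟩
  · intro w w' c hw
    simp [hashGen, hcorr w w' _ hw]
  · intro ι _ p hp hm
    have key := statDist_hashGen_sq_le (O := Fin ℓ → Bool) SS p hp hm
    have transport := statDist_transport (hashGen (O := Fin ℓ → Bool) SS) e f p
    have bound : (Fintype.card (Fin ℓ → Bool) : ℝ) *
        ((Finset.univ.image fun wr : M × R => SS wr.1 wr.2).card * 2 ^ (-m)) ≤ (2 * ε) ^ 2 := by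
      calc _ ≤ (2 : ℝ) ^ (ℓ : ℝ) * (2 ^ lam * 2 ^ (-m)) := by
            rw [Fintype.card_fun, Fintype.card_bool, Fintype.card_fin, Real.rpow_natCast]
            push_cast
            gcongr
        _ = 2 ^ (ℓ + lam - m : ℝ) := by
            rw [← Real.rpow_add two_pos, ← Real.rpow_add two_pos]
            ring_nf
        _ ≤ 2 ^ (2 * (1 + Real.logb 2 ε)) := by
            rw [one_div, Real.logb_inv] at hℓ
            exact Real.rpow_le_rpow_of_exponent_le one_le_two (by linarith)
        _ = (2 * ε) ^ 2 := by
            rw [mul_comm, Real.rpow_mul zero_le_two, Real.rpow_add two_pos,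
              Real.rpow_logb two_pos (by norm_num) hε0]
            norm_num
    have := abs_le_of_sq_le_sq' (key.trans bound) (by positivity)
    refine le_trans (le_of_eq ?_) (show statDist _ _ ≤ ε by linarith [this.2])
    convert transport
end

section
/- Fuzzy extractor for the Hamming metric: let F be a finite abelian group of size F with f = log₂ F, and let C ⊆ F^n be a code with K = F^k codewords and minimum Hamming distance at least 2t+1. Then for any m and any 0 < ε ≤ 1, there exists an average-case (F^n, m, ℓ, t, ε)-fuzzy extractor (for F^n with the Hamming metric) with ℓ = m + k·f − n·f − 2·log₂(1/ε) + 2. -/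
open Finset

section UniversalHashing

variable {M O : Type*} [Fintype M] [DecidableEq M] [Fintype O]

/-- Values of a uniformly random function at two distinct points are uncorrelated. -/
theorem sum_fun_mul_eq_zero {w w' : M} (hw : w ≠ w') (a b : O → ℝ) (ha : ∑ o, a o = 0) :
    ∑ h : M → O, a (h w) * b (h w') = 0 := by
  let f : M → O → ℝ := fun x o => (if x = w then a o else 1) * (if x = w' then b o else 1)
  have h₁ : ∏ x, ∑ o, f x o = 0 :=
    Finset.prod_eq_zero (Finset.mem_univ w) (by simp [f, hw, ha])
  rw [Finset.prod_univ_sum, Fintype.piFinset_univ] at h₁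
  rw [← h₁]
  refine Finset.sum_congr rfl fun h _ => ?_
  simp only [f, Finset.prod_mul_distrib, Finset.prod_ite_eq', Finset.mem_univ, if_true]

variable [DecidableEq O]

/-- Deviation of the indicator of `o = r` from its mean over uniform `o`. -/
noncomputable def centeredIndicator (o r : O) : ℝ :=
  (if o = r then 1 else 0) - 1 / (Fintype.card O : ℝ)

theorem sum_centeredIndicator_left [Nonempty O] (r : O) :
    ∑ o, centeredIndicator o r = 0 := by
  simp [centeredIndicator, Finset.sum_sub_distrib]

theorem sum_sq_centeredIndicator_le [Nonempty O] (o : O) :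
    ∑ r, centeredIndicator o r ^ 2 ≤ 1 := by
  have hL : (0 : ℝ) < Fintype.card O := by exact_mod_cast Fintype.card_pos
  have h : ∀ r : O, centeredIndicator o r ^ 2 =
      (if o = r then 1 - 2 / (Fintype.card O : ℝ) else 0) + 1 / (Fintype.card O : ℝ) ^ 2 := by
    intro r
    unfold centeredIndicator
    split_ifs <;> ring
  simp only [h, Finset.sum_add_distrib, Finset.sum_ite_eq, Finset.mem_univ, if_true,
    Finset.sum_const, Finset.card_univ, nsmul_eq_mul]
  have : (Fintype.card O : ℝ) * (1 / (Fintype.card O : ℝ) ^ 2) = 1 / (Fintype.card O : ℝ) := by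
    field_simp
  rw [this]
  have : 0 < 1 / (Fintype.card O : ℝ) := by positivity
  have e : 2 / (Fintype.card O : ℝ) = 2 * (1 / (Fintype.card O : ℝ)) := by ring
  linarith

theorem sum_sq_hash_deviation_le [Nonempty O] (q : M → ℝ) :
    ∑ h : M → O, ∑ r, (∑ w, q w * centeredIndicator (h w) r) ^ 2 ≤
      (Fintype.card (M → O) : ℝ) * ∑ w, q w ^ 2 := by
  have expand : ∑ h : M → O, ∑ r, (∑ w, q w * centeredIndicator (h w) r) ^ 2 =
      ∑ w, ∑ w', q w * q w' * ∑ r, ∑ h : M → O,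
        centeredIndicator (h w) r * centeredIndicator (h w') r := by
    simp only [sq, Finset.sum_mul_sum]
    simp only [Finset.mul_sum]
    rw [Finset.sum_comm]
    rw [Finset.sum_congr rfl fun r _ => Finset.sum_comm]
    rw [Finset.sum_comm]
    refine Finset.sum_congr rfl fun w _ => ?_
    rw [Finset.sum_congr rfl fun r _ => Finset.sum_comm]
    rw [Finset.sum_comm]
    refine Finset.sum_congr rfl fun w' _ => Finset.sum_congr rfl fun r _ =>
      Finset.sum_congr rfl fun h _ => by ring
  rw [expand, Finset.mul_sum]
  refine Finset.sum_le_sum fun w _ => ?_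
  rw [Finset.sum_eq_single w]
  · rw [Finset.sum_comm]
    have : ∑ h : M → O, ∑ r, centeredIndicator (h w) r * centeredIndicator (h w) r ≤
        ∑ _h : M → O, (1 : ℝ) :=
      Finset.sum_le_sum fun h _ => by simpa [sq] using sum_sq_centeredIndicator_le (h w)
    simp only [Finset.sum_const, Finset.card_univ, nsmul_eq_mul, mul_one] at this
    nlinarith [mul_le_mul_of_nonneg_left this (mul_self_nonneg (q w))]
  · intro w' _ hne
    rw [Finset.sum_eq_zero, mul_zero]
    intro r _
    exact sum_fun_mul_eq_zero hne.symm (fun o => centeredIndicator o r)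
      (fun o => centeredIndicator o r) (sum_centeredIndicator_left r)
  · simp

/-- Leftover hash lemma for the family of all functions, for unnormalised weights. -/
theorem sum_abs_hash_deviation_le [Nonempty O] (q : M → ℝ) :
    (∑ h : M → O, ∑ r, |∑ w, q w * centeredIndicator (h w) r|) ≤
      Fintype.card (M → O) * √(Fintype.card O * ∑ w, q w ^ 2) := by
  have cs := sq_sum_le_card_mul_sum_sq (s := (Finset.univ : Finset ((M → O) × O)))
    (f := fun x => |∑ w, q w * centeredIndicator (x.1 w) x.2|)
  simp only [sq_abs, Fintype.sum_prod_type, Finset.card_univ, Fintype.card_prod] at cs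
  refine (Real.le_sqrt_of_sq_le (cs.trans
    (mul_le_mul_of_nonneg_left (sum_sq_hash_deviation_le q) (by positivity)))).trans ?_
  refine Real.sqrt_le_iff.2 ⟨by positivity, ?_⟩
  rw [mul_pow, Real.sq_sqrt (mul_nonneg (by positivity)
    (Finset.sum_nonneg fun w _ => sq_nonneg _))]
  push_cast
  exact le_of_eq (by ring)

end UniversalHashing

section CodeOffset

variable {G O ι : Type*} [DecidableEq G] [AddCommGroup G]

/-- Publish the offset of `w` by a random codeword and a random function, and extract the value
of that function at `w`. -/
def codeOffsetGen (O : Type*) (C : Finset G) (w : G) (c : C × (G → O)) : O × (G × (G → O)) :=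
  (c.2 w, (w + c.1, c.2))

/-- Mass of `W = w`, `I = i` and published offset `s`. -/
noncomputable def offsetMass (C : Finset G) (p : G × ι → ℝ) (s : G) (i : ι) (w : G) : ℝ :=
  if s - w ∈ C then p (w, i) / (C.card : ℝ) else 0

theorem offsetMass_nonneg (C : Finset G) {p : G × ι → ℝ} (hp : ∀ x, 0 ≤ p x) (s : G) (i : ι)
    (w : G) : 0 ≤ offsetMass C p s i w := by
  unfold offsetMass
  split_ifs
  · exact div_nonneg (hp _) (by positivity)
  · exact le_rfl

variable [Fintype G]

theorem offsetMass_le (C : Finset G) {p : G × ι → ℝ} (hp : ∀ x, 0 ≤ p x) (s : G) (i : ι)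
    (w : G) : offsetMass C p s i w ≤ (⨆ w, p (w, i)) / (C.card : ℝ) := by
  have hle : p (w, i) ≤ ⨆ w, p (w, i) :=
    le_ciSup (f := fun w => p (w, i)) (Set.finite_range _).bddAbove w
  unfold offsetMass
  split_ifs
  · gcongr
  · exact div_nonneg ((hp _).trans hle) (by positivity)

theorem sum_sum_offsetMass {C : Finset G} (hC : C.Nonempty) (p : G × ι → ℝ) (i : ι) :
    ∑ s, ∑ w, offsetMass C p s i w = ∑ w, p (w, i) := by
  rw [Finset.sum_comm]
  refine Finset.sum_congr rfl fun w _ => ?_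
  have hcard : (C.card : ℝ) ≠ 0 := by exact_mod_cast hC.card_pos.ne'
  rw [← Equiv.sum_comp (Equiv.addRight w)]
  simp only [offsetMass, Equiv.coe_addRight, add_sub_cancel_right]
  rw [← Finset.sum_filter, Finset.filter_mem_eq_inter, Finset.univ_inter, Finset.sum_const,
    nsmul_eq_mul]
  field_simp

variable [Fintype O] [DecidableEq O] [Fintype ι]

theorem genDistI_codeOffsetGen (C : Finset G) (p : G × ι → ℝ) (r : O) (s : G) (h : G → O)
    (i : ι) :
    genDistI (codeOffsetGen O C) p (r, (s, h), i) =
      (∑ w, offsetMass C p s i w * (if h w = r then 1 else 0)) /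
        (Fintype.card (G → O) : ℝ) := by
  have key : ∀ w, (∑ c : C × (G → O),
      if codeOffsetGen O C w c = (r, (s, h)) then p (w, i) else 0) =
      (if s - w ∈ C then p (w, i) else 0) * (if h w = r then 1 else 0) := by
    intro w
    rw [Fintype.sum_prod_type]
    have inner : ∀ c : C, (∑ h' : G → O,
        if codeOffsetGen O C w (c, h') = (r, (s, h)) then p (w, i) else 0) =
        if (c : G) = s - w then (if h w = r then p (w, i) else 0) else 0 := by
      intro c
      rw [Finset.sum_eq_single h]
      · simp only [codeOffsetGen, Prod.mk.injEq, and_true, eq_sub_iff_add_eq', ite_and]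
        split_ifs <;> rfl
      · intro h' _ hne
        simp [codeOffsetGen, hne]
      · simp
    simp only [inner]
    rw [Finset.sum_coe_sort C
      (fun c => if c = s - w then (if h w = r then p (w, i) else 0) else 0)]
    rw [Finset.sum_ite_eq']
    split_ifs <;> simp
  simp only [genDistI, Fintype.sum_prod_type] at key ⊢
  simp only [key, Fintype.card_prod, Fintype.card_coe, offsetMass]
  push_cast
  rw [← div_div, Finset.sum_div]
  congr 1
  refine Finset.sum_congr rfl fun w _ => ?_
  split_ifs <;> simp

theorem genDistI_sub_genUniI_codeOffsetGen (C : Finset G) (p : G × ι → ℝ) (r : O) (s : G)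
    (h : G → O) (i : ι) :
    genDistI (codeOffsetGen O C) p (r, (s, h), i) -
        genUniI (codeOffsetGen O C) p (r, (s, h), i) =
      (∑ w, offsetMass C p s i w * centeredIndicator (h w) r) /
        (Fintype.card (G → O) : ℝ) := by
  simp only [genUniI, genDistI_codeOffsetGen]
  rw [← Finset.sum_div, Finset.sum_comm]
  simp only [← Finset.mul_sum, Finset.sum_ite_eq, Finset.mem_univ, if_true, mul_one,
    centeredIndicator, mul_sub, Finset.sum_sub_distrib]
  rw [← Finset.sum_mul]
  ring

theorem statDist_codeOffsetGen_le [Nonempty O] {C : Finset G} (hC : C.Nonempty)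
    {p : G × ι → ℝ} (hp : IsDist p) :
    statDist (genDistI (codeOffsetGen O C) p) (genUniI (codeOffsetGen O C) p) ≤
      √(Fintype.card O * Fintype.card G / C.card * ∑ i, ⨆ w, p (w, i)) / 2 := by
  have hH : (0 : ℝ) < Fintype.card (G → O) := by exact_mod_cast Fintype.card_pos
  have hsup : ∀ i, 0 ≤ ⨆ w, p (w, i) := fun i => Real.iSup_nonneg fun w => hp.1 _
  have hmass : ∀ x : G × ι, 0 ≤ ∑ w, offsetMass C p x.1 x.2 w := fun x =>
    Finset.sum_nonneg fun w _ => offsetMass_nonneg C hp.1 _ _ w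
  unfold statDist
  gcongr
  calc ∑ v, |genDistI (codeOffsetGen O C) p v - genUniI (codeOffsetGen O C) p v|
      = ∑ x : G × ι, (∑ h : G → O, ∑ r,
          |∑ w, offsetMass C p x.1 x.2 w * centeredIndicator (h w) r|) /
            Fintype.card (G → O) := by
        simp only [Fintype.sum_prod_type, genDistI_sub_genUniI_codeOffsetGen, abs_div,
          Nat.abs_cast, ← Finset.sum_div]
        congr 1
        rw [Finset.sum_comm]
        refine Finset.sum_congr rfl fun s _ => ?_
        rw [Finset.sum_congr rfl fun r _ => Finset.sum_comm, Finset.sum_comm]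
        refine Finset.sum_congr rfl fun i _ => ?_
        rw [Finset.sum_comm]
    _ ≤ ∑ x : G × ι, √(Fintype.card O * ((⨆ w, p (w, x.2)) / C.card)) *
          √(∑ w, offsetMass C p x.1 x.2 w) := by
        refine Finset.sum_le_sum fun x _ => ?_
        rw [div_le_iff₀' hH]
        refine (sum_abs_hash_deviation_le _).trans ?_
        rw [← Real.sqrt_mul (mul_nonneg (by positivity) (div_nonneg (hsup _) (by positivity))),
          mul_assoc, Finset.mul_sum (a := (⨆ w, p (w, x.2)) / (C.card : ℝ))]
        gcongr with w
        rw [sq]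
        exact mul_le_mul_of_nonneg_right (offsetMass_le C hp.1 _ _ w)
          (offsetMass_nonneg C hp.1 _ _ w)
    _ ≤ √(∑ x : G × ι, Fintype.card O * ((⨆ w, p (w, x.2)) / C.card)) *
          √(∑ x : G × ι, ∑ w, offsetMass C p x.1 x.2 w) :=
        Real.sum_sqrt_mul_sqrt_le _
          (fun x => mul_nonneg (by positivity) (div_nonneg (hsup _) (by positivity))) hmass
    _ = √(Fintype.card O * Fintype.card G / C.card * ∑ i, ⨆ w, p (w, i)) := by
        have htotal : ∑ x : G × ι, ∑ w, offsetMass C p x.1 x.2 w = 1 := by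
          rw [Fintype.sum_prod_type_right]
          simp only [sum_sum_offsetMass hC]
          rw [← hp.2, Fintype.sum_prod_type_right]
        rw [htotal, Real.sqrt_one, mul_one]
        congr 1
        simp only [Fintype.sum_prod_type, Finset.sum_const, Finset.card_univ, nsmul_eq_mul,
          ← Finset.mul_sum, ← Finset.sum_div]
        ring

end CodeOffset

section Reindexing

variable {M K K' O P P' ι : Type*} [Fintype M] [Fintype K] [Fintype K'] [Fintype O] [Fintype P]
  [Fintype P'] [Fintype ι] [DecidableEq O] [DecidableEq P] [DecidableEq P']

/-- Relabel the coins and the helper strings of a generation procedure. -/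
def relabelGen (Gen : M → K → O × P) (eK : K' ≃ K) (eP : P ≃ P') (w : M) (c : K') : O × P' :=
  ((Gen w (eK c)).1, eP (Gen w (eK c)).2)

theorem genDistI_relabelGen (Gen : M → K → O × P) (eK : K' ≃ K) (eP : P ≃ P')
    (p : M × ι → ℝ) (r : O) (x : P) (i : ι) :
    genDistI (relabelGen Gen eK eP) p (r, eP x, i) = genDistI Gen p (r, x, i) := by
  simp only [genDistI, Fintype.card_congr eK, relabelGen, Fintype.sum_prod_type]
  congr 1
  refine Finset.sum_congr rfl fun w _ => ?_
  rw [← eK.sum_comp]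
  simp only [Prod.ext_iff, eP.apply_eq_iff_eq]

theorem statDist_relabelGen (Gen : M → K → O × P) (eK : K' ≃ K) (eP : P ≃ P')
    (p : M × ι → ℝ) :
    statDist (genDistI (relabelGen Gen eK eP) p) (genUniI (relabelGen Gen eK eP) p) =
      statDist (genDistI Gen p) (genUniI Gen p) := by
  simp only [statDist, Fintype.sum_prod_type]
  congr 1
  refine Finset.sum_congr rfl fun r _ => ?_
  rw [← eP.sum_comp]
  simp only [genUniI, genDistI_relabelGen]

end Reindexing

/-- Decoding of a code that corrects `t` errors in the Hamming metric. -/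
theorem exists_decoder {𝔽 : Type*} [DecidableEq 𝔽] {n : ℕ} (C : Finset (Fin n → 𝔽)) (t : ℕ)
    (hmin : ∀ c₁ ∈ C, ∀ c₂ ∈ C, c₁ ≠ c₂ → 2 * t + 1 ≤ hammingDist c₁ c₂) :
    ∃ dec : (Fin n → 𝔽) → (Fin n → 𝔽), ∀ c ∈ C, ∀ x, hammingDist c x ≤ t → dec x = c := by
  classical
  refine ⟨fun x => if h : ∃ c ∈ C, hammingDist c x ≤ t then h.choose else x, ?_⟩
  intro c hc x hx
  have h : ∃ c ∈ C, hammingDist c x ≤ t := ⟨c, hc, hx⟩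
  simp only [dif_pos h]
  obtain ⟨h₁, h₂⟩ := h.choose_spec
  by_contra hne
  have := hmin _ h₁ _ hc hne
  have := hammingDist_triangle_right h.choose c x
  omega

theorem sum_iSup_pos {M ι : Type*} [Fintype M] [Fintype ι] {p : M × ι → ℝ} (hp : IsDist p) :
    0 < ∑ i, ⨆ w, p (w, i) := by
  have hsup : ∀ i, 0 ≤ ⨆ w, p (w, i) := fun i => Real.iSup_nonneg fun w => hp.1 _
  refine lt_of_le_of_ne (Finset.sum_nonneg fun i _ => hsup i) fun h0 => ?_
  have hzero := (Finset.sum_eq_zero_iff_of_nonneg fun i _ => hsup i).1 h0.symm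
  have : ∑ x, p x = 0 := Finset.sum_eq_zero fun x _ =>
    le_antisymm ((le_ciSup (f := fun w => p (w, x.2)) (Set.finite_range _).bddAbove x.1).trans
      (hzero x.2 (Finset.mem_univ _)).le) (hp.1 x)
  linarith [hp.2]

/-- Fuzzy extractor for the Hamming metric: given a code `C ⊆ 𝔽ⁿ` with
`|𝔽|^k` codewords and minimum Hamming distance at least `2t+1`, for any `m` and any
`0 < ε ≤ 1` there exists an average-case `(𝔽ⁿ, m, ℓ, t, ε)`-fuzzy extractor with
`ℓ = m + k·f − n·f − 2·log₂(1/ε) + 2` where `f = log₂|𝔽|` (i.e. extracting any `ℓ` up to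
that bound). -/
theorem hamming_fuzzy_extractor {𝔽 : Type} [Fintype 𝔽] [DecidableEq 𝔽] [AddCommGroup 𝔽]
    {n k : ℕ} (C : Finset (Fin n → 𝔽)) (t : ℕ)
    (hK : C.card = Fintype.card 𝔽 ^ k)
    (hmin : ∀ c₁ ∈ C, ∀ c₂ ∈ C, c₁ ≠ c₂ → 2 * t + 1 ≤ hammingDist c₁ c₂)
    (m ε : ℝ) (hε0 : 0 < ε) (hε1 : ε ≤ 1) (ℓ : ℕ)
    (hℓ : (ℓ : ℝ) ≤ m + (k : ℝ) * Real.logb 2 (Fintype.card 𝔽 : ℝ)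
      - (n : ℝ) * Real.logb 2 (Fintype.card 𝔽 : ℝ) - 2 * Real.logb 2 (1 / ε) + 2) :
    ∃ (N N' : ℕ), 0 < N ∧
      ∃ (Gen : (Fin n → 𝔽) → Fin N → (Fin ℓ → Bool) × Fin N')
        (Rep : (Fin n → 𝔽) → Fin N' → (Fin ℓ → Bool)),
        -- correctness
        (∀ (w w' : Fin n → 𝔽) (c : Fin N), hammingDist w w' ≤ t →
          Rep w' (Gen w c).2 = (Gen w c).1) ∧
        -- average-case security
        ∀ (ι : Type) [Fintype ι] (p : (Fin n → 𝔽) × ι → ℝ),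
          IsDist p → m ≤ avgMinEntropy p →
            statDist (genDistI Gen p) (genUniI Gen p) ≤ ε := by
  classical
  have hF : 0 < Fintype.card 𝔽 := Fintype.card_pos
  have hC : C.Nonempty := Finset.card_pos.1 (by rw [hK]; positivity)
  obtain ⟨dec, hdec⟩ := exists_decoder C t hmin
  let H := (Fin n → 𝔽) → Fin ℓ → Bool
  let eK := (Fintype.equivFin (C × H)).symm
  let eP := Fintype.equivFin ((Fin n → 𝔽) × H)
  have : Nonempty C := hC.to_subtype
  refine ⟨Fintype.card (C × H), Fintype.card ((Fin n → 𝔽) × H), Fintype.card_pos,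
    relabelGen (codeOffsetGen (Fin ℓ → Bool) C) eK eP,
    fun w' x => (eP.symm x).2 ((eP.symm x).1 - dec ((eP.symm x).1 - w')), ?_, ?_⟩
  · intro w w' c hww
    simp only [relabelGen, codeOffsetGen, Equiv.symm_apply_apply]
    have hdist : hammingDist ((eK c).1 : Fin n → 𝔽) (w + (eK c).1 - w') ≤ t := by
      refine le_trans (le_of_eq ?_) hww
      rw [hammingDist_eq_hammingNorm, hammingDist_comm w w', hammingDist_eq_hammingNorm w' w]
      congr 1
      abel
    rw [hdec _ (eK c).1.2 _ hdist, add_sub_cancel_right]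
  · intro ι _ p hp hm
    rw [statDist_relabelGen]
    refine (statDist_codeOffsetGen_le hC hp).trans ?_
    have hS := sum_iSup_pos hp
    rw [div_le_iff₀ two_pos]
    refine Real.sqrt_le_iff.2 ⟨by positivity, ?_⟩
    have hFr : (0 : ℝ) < Fintype.card 𝔽 := by exact_mod_cast hF
    simp only [hK, Fintype.card_fun, Fintype.card_bool, Fintype.card_fin]
    push_cast
    rw [← Real.logb_le_logb one_lt_two (by positivity) (by positivity),
      Real.logb_mul (by positivity) hS.ne', Real.logb_div (by positivity) (by positivity),
      Real.logb_mul (by positivity) (by positivity), Real.logb_pow, Real.logb_pow, Real.logb_pow,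
      Real.logb_self_eq_one one_lt_two, Real.logb_pow, Real.logb_mul hε0.ne' two_ne_zero,
      Real.logb_self_eq_one one_lt_two]
    rw [one_div, Real.logb_inv] at hℓ
    unfold avgMinEntropy at hm
    push_cast
    linarith
end
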